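/- Let (X,⊥) be a homogeneously transitive orthoset containing four mutually orthogonal elements and let e, f ∈ X be distinct. Then: (i) the orbit G_{ef}(e) = {φ(e) : φ ∈ G_{ef}} equals {e,f}^⊥⊥; (ii) the set of common fixed points {x ∈ X : φ(x) = x for all φ ∈ G_{ef}} equals {e,f}^⊥; (iii) for any further distinct e', f' ∈ X, G_{ef} = G_{e'f'} if and only if {e,f}^⊥ = {e',f'}^⊥. -/

import Mathlib

/-- An automorphism of the orthoset `(X, perp)`. -/
def IsOrthoAuto {X : Type*} (perp : X → X → Prop) (φ : Equiv.Perm X) : Prop :=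
  ∀ p q : X, perp p q ↔ perp (φ p) (φ q)

/-- The group `G_{ef}`. -/
def Gef {X : Type*} (perp : X → X → Prop) (e f : X) : Set (Equiv.Perm X) :=
  {φ | IsOrthoAuto perp φ ∧ ∀ x : X, perp x e → perp x f → φ x = x}

/-- Homogeneous transitivity: (HT1) and (HT2). -/
def HomTrans {X : Type*} (perp : X → X → Prop) : Prop :=
  ∀ e f : X, e ≠ f →
    (∃ φ ∈ Gef perp e f, φ e = f) ∧
    (∀ e' f' : X, e' ≠ f' → ∃ τ : Equiv.Perm X, IsOrthoAuto perp τ ∧ τ e = e' ∧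
      Gef perp e f = (fun φ => τ⁻¹ * φ * τ) '' Gef perp e' f')

/-- The orthocomplement of a subset of an orthoset. -/
def pperp {X : Type*} (perp : X → X → Prop) (A : Set X) : Set X :=
  {q | ∀ p ∈ A, perp q p}

section Orthoset

variable {X : Type*} {perp : X → X → Prop}

theorem mem_pperp_pair (perp : X → X → Prop) {e f x : X} :
    x ∈ pperp perp ({e, f} : Set X) ↔ perp x e ∧ perp x f := by
  simp [pperp]

theorem perm_apply_inv_apply (φ : Equiv.Perm X) (x : X) : φ (φ⁻¹ x) = x :=
  φ.apply_symm_apply x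

theorem ne_of_perp (hirr : ∀ x : X, ¬ perp x x) {a b : X} (h : perp a b) : a ≠ b := by
  rintro rfl
  exact hirr _ h

/-- A common fixed point of `G_{ef}` orthogonal to `e` is orthogonal to `f`. -/
theorem perp_right_of_gef_fixed (hht : HomTrans perp) {e f x : X} (hef : e ≠ f)
    (hx : ∀ φ ∈ Gef perp e f, φ x = x) (hxe : perp x e) : perp x f := by
  obtain ⟨φ, hφ, rfl⟩ := (hht e f hef).1
  have h := (hφ.1 x e).1 hxe
  rwa [hx φ hφ] at h

/-- The element `f` may be replaced by some `g ⊥ e` with `{e,f}^⊥ = {e,g}^⊥`. -/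
theorem exists_perp_complement (hirr : ∀ x : X, ¬ perp x x)
    (hht : HomTrans perp) {a b e f : X} (hba : perp b a) (hef : e ≠ f) :
    ∃ g, perp g e ∧ ∀ x, perp x e → (perp x f ↔ perp x g) := by
  have hne : a ≠ b := (ne_of_perp hirr hba).symm
  obtain ⟨τ, hτ, rfl, hG⟩ := (hht e f hef).2 a b hne
  have hg : ∀ x, perp x (τ⁻¹ b) ↔ perp (τ x) b := fun x => by
    rw [hτ x (τ⁻¹ b), perm_apply_inv_apply]
  refine ⟨τ⁻¹ b, ?_, fun x hxe => ⟨fun hxf => ?_, fun hxg => ?_⟩⟩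
  · rwa [hτ, perm_apply_inv_apply]
  · refine (hg x).2 (perp_right_of_gef_fixed hht hne (fun ψ hψ => ?_) ((hτ _ _).1 hxe))
    have hmem : τ⁻¹ * ψ * τ ∈ Gef perp e f := hG ▸ ⟨ψ, hψ, rfl⟩
    exact Equiv.Perm.inv_eq_iff_eq.1 (hmem.2 x hxe hxf)
  · refine perp_right_of_gef_fixed hht hef (fun φ hφ => ?_) hxe
    rw [hG] at hφ
    obtain ⟨ψ, hψ, rfl⟩ := hφ
    have h := hψ.2 (τ x) ((hτ _ _).1 hxe) ((hg x).1 hxg)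
    simp [Equiv.Perm.mul_apply, h]

/-- Orthogonal complements of `e` inside `{e,f}^⊥⊥` are unique. -/
theorem perp_complement_unique (hsymm : ∀ x y : X, perp x y → perp y x)
    (hirr : ∀ x : X, ¬ perp x x) (hht : HomTrans perp) {a b e f g : X} (hba : perp b a)
    (hef : perp e f) (heg : perp e g) (h : ∀ x, perp x e → perp x f → perp x g) : f = g := by
  by_contra hne
  obtain ⟨k, hkf, hk⟩ := exists_perp_complement hirr hht hba hne
  have hke : perp k e := hsymm _ _ ((hk e hef).1 heg)
  exact hirr k ((hk k hkf).1 (h k hke hkf))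

theorem exists_gef_apply_eq (hht : HomTrans perp) {e f h : X}
    (hh : ∀ x, perp x e → perp x f → perp x h) : ∃ φ ∈ Gef perp e f, φ e = h := by
  by_cases he : e = h
  · exact ⟨1, ⟨fun _ _ => Iff.rfl, fun _ _ _ => rfl⟩, he⟩
  · obtain ⟨φ, hφ, hφe⟩ := (hht e h he).1
    exact ⟨φ, ⟨hφ.1, fun x hxe hxf => hφ.2 x hxe (hh x hxe hxf)⟩, hφe⟩

/-- No element of `{e,f}^⊥⊥` is fixed by all of `G_{ef}`. -/
theorem not_gef_fixed (hht : HomTrans perp) {e f h : X} (hef : e ≠ f)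
    (hh : ∀ x, perp x e → perp x f → perp x h) : ¬ ∀ φ ∈ Gef perp e f, φ h = h := by
  intro hfix
  obtain ⟨ψ, hψ, hψe⟩ := exists_gef_apply_eq hht hh
  obtain rfl : e = h := ψ.injective (hψe.trans (hfix ψ hψ).symm)
  obtain ⟨φ, hφ, hφe⟩ := (hht e f hef).1
  exact hef ((hfix φ hφ).symm.trans hφe)

theorem perp_of_forall_gef_fixed (hsymm : ∀ x y : X, perp x y → perp y x)
    (hirr : ∀ x : X, ¬ perp x x) (hht : HomTrans perp) {a b e f x : X} (hba : perp b a)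
    (hef : e ≠ f) (hx : ∀ φ ∈ Gef perp e f, φ x = x) : perp x e ∧ perp x f := by
  by_cases hxe : perp x e
  · exact ⟨hxe, perp_right_of_gef_fixed hht hef hx hxe⟩
  exfalso
  have hx' : ¬ ∀ u, perp u e → perp u f → perp u x := fun h => not_gef_fixed hht hef h hx
  have hex : e ≠ x := by
    rintro rfl
    exact hx' fun u hu _ => hu
  obtain ⟨g, hge, hg⟩ := exists_perp_complement hirr hht hba hef
  obtain ⟨y, hye, hy⟩ := exists_perp_complement hirr hht hba hex
  have hgy : g ≠ y := by
    rintro rfl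
    exact hx' fun u hue huf => (hy u hue).2 ((hg u hue).1 huf)
  obtain ⟨k, hkg, hk⟩ := exists_perp_complement hirr hht hba hgy
  have hke : perp k e := hsymm _ _ ((hk e (hsymm _ _ hge)).1 (hsymm _ _ hye))
  have hkx : k ≠ x := by
    rintro rfl
    exact hxe hke
  obtain ⟨z, hzk, hz⟩ := exists_perp_complement hirr hht hba hkx
  refine not_gef_fixed hht hef (h := z) (fun u hue huf => ?_) (fun φ hφ => ?_)
  · have hug := (hg u hue).1 huf
    by_cases huk : k = u
    · exact huk ▸ hsymm _ _ hzk
    -- It suffices to treat the part of `u` orthogonal to `k`.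
    obtain ⟨v, hvk, hv⟩ := exists_perp_complement hirr hht hba huk
    have hve : perp v e := hsymm _ _ ((hv e (hsymm _ _ hke)).1 (hsymm _ _ hue))
    have hvg : perp v g := hsymm _ _ ((hv g (hsymm _ _ hkg)).1 (hsymm _ _ hug))
    have hvz : perp v z := (hz v hvk).1 ((hy v hve).2 ((hk v hvg).2 hvk))
    exact hsymm _ _ ((hv z hzk).2 (hsymm _ _ hvz))
  · have hφk : φ k = k := hφ.2 k hke ((hg k hke).2 hkg)
    have hkφz : perp k (φ z) := by
      have h := (hφ.1 k z).1 (hsymm _ _ hzk)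
      rwa [hφk] at h
    refine (perp_complement_unique hsymm hirr hht hba (hsymm _ _ hzk) hkφz
      fun u huk huz => ?_).symm
    have hux := (hz u huk).2 huz
    have huk' : perp (φ⁻¹ u) k := by
      rwa [hφ.1, perm_apply_inv_apply, hφk]
    have hux' : perp (φ⁻¹ u) x := by
      rwa [hφ.1, perm_apply_inv_apply, hx φ hφ]
    have h := (hφ.1 _ _).1 ((hz _ huk').1 hux')
    rwa [perm_apply_inv_apply] at h

end Orthoset

theorem stmt_15 {X : Type*} [Nonempty X] (perp : X → X → Prop)
    (hsymm : ∀ x y : X, perp x y → perp y x)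
    (hirr : ∀ x : X, ¬ perp x x)
    (hht : HomTrans perp)
    (hrank : ∃ a b c d : X,
      perp a b ∧ perp a c ∧ perp a d ∧ perp b c ∧ perp b d ∧ perp c d)
    (e f : X) (hef : e ≠ f) :
    ((fun φ : Equiv.Perm X => φ e) '' Gef perp e f
      = pperp perp (pperp perp ({e, f} : Set X))) ∧
    ({x : X | ∀ φ ∈ Gef perp e f, φ x = x} = pperp perp ({e, f} : Set X)) ∧
    (∀ e' f' : X, e' ≠ f' →
      (Gef perp e f = Gef perp e' f' ↔
        pperp perp ({e, f} : Set X) = pperp perp ({e', f'} : Set X))) := by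
  obtain ⟨a, b, -, -, hab, -⟩ := hrank
  have hfix : ∀ e f : X, e ≠ f →
      {x : X | ∀ φ ∈ Gef perp e f, φ x = x} = pperp perp ({e, f} : Set X) := by
    intro e f hef
    ext x
    rw [mem_pperp_pair]
    exact ⟨fun hx => perp_of_forall_gef_fixed hsymm hirr hht (hsymm _ _ hab) hef hx,
      fun hx φ hφ => hφ.2 x hx.1 hx.2⟩
  refine ⟨?_, hfix e f hef, fun e' f' hef' => ⟨fun h => ?_, fun h => ?_⟩⟩
  · ext h
    constructor
    · rintro ⟨φ, hφ, rfl⟩ x hx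
      rw [mem_pperp_pair] at hx
      have hx' := (hφ.1 x e).1 hx.1
      rw [hφ.2 x hx.1 hx.2] at hx'
      exact hsymm _ _ hx'
    · intro hh
      exact exists_gef_apply_eq hht fun x hxe hxf =>
        hsymm _ _ (hh x ((mem_pperp_pair perp).2 ⟨hxe, hxf⟩))
  · rw [← hfix e f hef, ← hfix e' f' hef', h]
  · have hiff : ∀ x, (perp x e ∧ perp x f) ↔ (perp x e' ∧ perp x f') := fun x => by
      rw [← mem_pperp_pair, ← mem_pperp_pair, h]
    ext φ
    simp only [Gef, Set.mem_ofPred_eq, ← and_imp, hiff]
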